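/- Let α, β > -1 be real numbers. Then the Fourier–Jacobi coefficients satisfy lim_{k→∞} f̂_{(α,β)}(k) = 0 for every f ∈ L_{(α,β)} if and only if (α, β) ∈ S, i.e. if and only if α ≥ β > -1 and α ≥ -1/2. -/

import Mathlib

open MeasureTheory Filter Set

noncomputable section

/-- Generalized binomial coefficient `C(a, m) = Γ(a+1)/(Γ(m+1)Γ(a-m+1))`. -/
def genBinom (a : ℝ) (m : ℕ) : ℝ :=
  Real.Gamma (a + 1) / (Real.Gamma ((m : ℝ) + 1) * Real.Gamma (a - (m : ℝ) + 1))

/-- The Jacobi polynomial `P_k^{(α,β)}(x)`. -/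
def jacobiP (α β : ℝ) (k : ℕ) (x : ℝ) : ℝ :=
  ∑ s ∈ Finset.range (k + 1),
    genBinom ((k : ℝ) + α) (k - s) * genBinom ((k : ℝ) + β) s *
      ((x - 1) / 2) ^ s * ((x + 1) / 2) ^ (k - s)

/-- The normalized Jacobi polynomial `R_k^{(α,β)}(x) = P_k^{(α,β)}(x)/P_k^{(α,β)}(1)`. -/
def jacobiR (α β : ℝ) (k : ℕ) (x : ℝ) : ℝ := jacobiP α β k x / jacobiP α β k 1

/-- The Jacobi weight `(sin(θ/2))^{2α+1} (cos(θ/2))^{2β+1}`. -/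
def jacobiWeight (α β : ℝ) (θ : ℝ) : ℝ :=
  Real.sin (θ / 2) ^ (2 * α + 1) * Real.cos (θ / 2) ^ (2 * β + 1)

/-- `f ∈ L_{(α,β)}`: `f` is integrable on `[0,π]` against the Jacobi weight. -/
def MemJacobiL (α β : ℝ) (f : ℝ → ℝ) : Prop :=
  IntegrableOn (fun θ => f θ * jacobiWeight α β θ) (Ioc 0 Real.pi)

/-- The norm `‖f‖_{L_{(α,β)}}`. -/
def jacobiNorm (α β : ℝ) (f : ℝ → ℝ) : ℝ :=
  ∫ θ in Ioc (0 : ℝ) Real.pi, |f θ| * jacobiWeight α β θ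

/-- The `k`-th Fourier–Jacobi coefficient `f̂_{(α,β)}(k)`. -/
def fourierJacobi (α β : ℝ) (f : ℝ → ℝ) (k : ℕ) : ℝ :=
  ∫ θ in Ioc (0 : ℝ) Real.pi, f θ * jacobiR α β k (Real.cos θ) * jacobiWeight α β θ

end

open Polynomial in
/-- The Jacobi polynomial as an element of `ℝ[X]`. -/
noncomputable def jacobiPoly (α β : ℝ) (k : ℕ) : ℝ[X] :=
  ∑ s ∈ Finset.range (k + 1),
    C (genBinom ((k : ℝ) + α) (k - s) * genBinom ((k : ℝ) + β) s) *
      ((C (1 / 2) * (X - 1)) ^ s * (C (1 / 2) * (X + 1)) ^ (k - s))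

lemma eval_jacobiPoly (α β : ℝ) (k : ℕ) (x : ℝ) :
    (jacobiPoly α β k).eval x = jacobiP α β k x := by
  simp only [jacobiPoly, jacobiP, Polynomial.eval_finsetSum, Polynomial.eval_mul,
    Polynomial.eval_pow, Polynomial.eval_C, Polynomial.eval_sub, Polynomial.eval_add,
    Polynomial.eval_X, Polynomial.eval_one]
  refine Finset.sum_congr rfl fun s _ => ?_
  rw [show (1 / 2 : ℝ) * (x - 1) = (x - 1) / 2 by ring,
    show (1 / 2 : ℝ) * (x + 1) = (x + 1) / 2 by ring]
  ring

lemma genBinom_pair (α : ℝ) (hα : -1 < α) (n s : ℕ) :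
    (α + s + 1) * genBinom (((n + s + 1 : ℕ) : ℝ) + α) n =
      (n + 1) * genBinom (((n + s + 1 : ℕ) : ℝ) + α) (n + 1) := by
  have hs : (0 : ℝ) ≤ s := s.cast_nonneg
  have hn : (0 : ℝ) ≤ n := n.cast_nonneg
  have e1 : Real.Gamma (((n + 1 : ℕ) : ℝ) + 1) = (n + 1) * Real.Gamma (n + 1) := by
    push_cast
    exact Real.Gamma_add_one (by positivity)
  have e2 : Real.Gamma (((n + s + 1 : ℕ) : ℝ) + α - n + 1)
      = (α + s + 1) * Real.Gamma (α + s + 1) := by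
    rw [← Real.Gamma_add_one (by linarith)]
    congr 1
    push_cast
    ring
  have e3 : ((n + s + 1 : ℕ) : ℝ) + α - ((n + 1 : ℕ) : ℝ) + 1 = α + s + 1 := by
    push_cast
    ring
  have p1 : Real.Gamma ((n : ℝ) + 1) ≠ 0 := (Real.Gamma_pos_of_pos (by linarith)).ne'
  have p2 : Real.Gamma (α + s + 1) ≠ 0 := (Real.Gamma_pos_of_pos (by linarith)).ne'
  have p3 : α + s + 1 ≠ 0 := by linarith
  have p4 : (n : ℝ) + 1 ≠ 0 := by positivity
  unfold genBinom
  rw [e1, e2, e3]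
  field_simp

lemma jacobi_coeff_recurrence (α β : ℝ) (hα : -1 < α) (hβ : -1 < β) (n s : ℕ) :
    genBinom (((n + s + 1 : ℕ) : ℝ) + α) n * genBinom (((n + s + 1 : ℕ) : ℝ) + β) (s + 1) *
        ((s + 1) * (s + 1 + α)) =
      genBinom (((n + s + 1 : ℕ) : ℝ) + α) (n + 1) * genBinom (((n + s + 1 : ℕ) : ℝ) + β) s *
        ((n + 1) * (n + 1 + β)) := by
  have h1 := genBinom_pair α hα n s
  have h2 := genBinom_pair β hβ s n
  rw [show s + n + 1 = n + s + 1 by ring] at h2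
  linear_combination
    genBinom (((n + s + 1 : ℕ) : ℝ) + β) (s + 1) * (s + 1) * h1 -
      genBinom (((n + s + 1 : ℕ) : ℝ) + α) (n + 1) * (n + 1) * h2

open Polynomial in
lemma jacobi_operator_monomial (α β : ℝ) (s n : ℕ) (x : ℝ) (t : ℝ[X])
    (ht : t = (C (1 / 2) * (X - 1)) ^ s * (C (1 / 2) * (X + 1)) ^ n) :
    (1 - x ^ 2) * (derivative (derivative t)).eval x
        + (β - α - (α + β + 2) * x) * (derivative t).eval x
        + (s + n) * (s + n + α + β + 1) * t.eval x =
      n * (n + β) * (((x - 1) / 2) ^ s * ((x + 1) / 2) ^ (n - 1))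
        - s * (s + α) * (((x - 1) / 2) ^ (s - 1) * ((x + 1) / 2) ^ n) := by
  subst ht
  rcases s with _ | _ | s <;> rcases n with _ | _ | n <;>
    simp [derivative_mul, derivative_pow] <;> ring

open Polynomial in
lemma jacobiPoly_ode (α β : ℝ) (hα : -1 < α) (hβ : -1 < β) (k : ℕ) (x : ℝ) :
    (1 - x ^ 2) * (derivative (derivative (jacobiPoly α β k))).eval x
        + (β - α - (α + β + 2) * x) * (derivative (jacobiPoly α β k)).eval x
        + k * (k + α + β + 1) * (jacobiPoly α β k).eval x = 0 := by
  simp only [jacobiPoly, derivative_sum, derivative_C_mul, eval_finsetSum, eval_C_mul]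
  simp only [Finset.mul_sum, ← Finset.sum_add_distrib]
  have key : ∀ s ∈ Finset.range (k + 1), ∀ c : ℝ, ∀ t : ℝ[X],
      t = (C (1 / 2) * (X - 1)) ^ s * (C (1 / 2) * (X + 1)) ^ (k - s) →
      (1 - x ^ 2) * (c * (derivative (derivative t)).eval x)
        + (β - α - (α + β + 2) * x) * (c * (derivative t).eval x)
        + k * (k + α + β + 1) * (c * t.eval x) =
      c * (((k - s : ℕ) : ℝ) * (((k - s : ℕ) : ℝ) + β) *
          (((x - 1) / 2) ^ s * ((x + 1) / 2) ^ (k - s - 1)))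
        - c * (s * (s + α) * (((x - 1) / 2) ^ (s - 1) * ((x + 1) / 2) ^ (k - s))) := by
    intro s hs c t ht
    have hsk : s ≤ k := Nat.lt_succ_iff.mp (Finset.mem_range.mp hs)
    have h := jacobi_operator_monomial α β s (k - s) x t ht
    have hk : (s : ℝ) + ((k - s : ℕ) : ℝ) = k := by
      rw [Nat.cast_sub hsk]
      ring
    rw [hk] at h
    linear_combination c * h
  rw [Finset.sum_congr rfl fun s hs => key s hs _ _ rfl, Finset.sum_sub_distrib,
    Finset.sum_range_succ, Finset.sum_range_succ']
  simp only [Nat.sub_self, Nat.cast_zero, zero_mul, mul_zero, add_zero]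
  rw [sub_eq_zero]
  refine Finset.sum_congr rfl fun s hs => ?_
  obtain ⟨n, rfl⟩ : ∃ n, k = n + s + 1 :=
    ⟨k - s - 1, by have := Finset.mem_range.mp hs; omega⟩
  have h := jacobi_coeff_recurrence α β hα hβ n s
  rw [show n + s + 1 - s = n + 1 by omega, show n + s + 1 - (s + 1) = n by omega,
    show n + 1 - 1 = n by omega, show s + 1 - 1 = s by omega]
  push_cast at h ⊢
  linear_combination -(((x - 1) / 2) ^ s * ((x + 1) / 2) ^ n) * h

lemma jacobiP_one (α β : ℝ) (hβ : -1 < β) (k : ℕ) :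
    jacobiP α β k 1 = genBinom (k + α) k := by
  have h : Real.Gamma ((k : ℝ) + β + 1) ≠ 0 :=
    (Real.Gamma_pos_of_pos (by have := k.cast_nonneg (α := ℝ); linarith)).ne'
  rw [jacobiP, Finset.sum_range_succ']
  simp [genBinom, h]

lemma jacobiP_neg_one (α β : ℝ) (hα : -1 < α) (k : ℕ) :
    jacobiP α β k (-1) = (-1) ^ k * genBinom (k + β) k := by
  have h : Real.Gamma ((k : ℝ) + α + 1) ≠ 0 :=
    (Real.Gamma_pos_of_pos (by have := k.cast_nonneg (α := ℝ); linarith)).ne'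
  rw [jacobiP, Finset.sum_range_succ, Finset.sum_eq_zero]
  · norm_num [genBinom, h]
    ring
  · intro s hs
    have : k - s ≠ 0 := by have := Finset.mem_range.mp hs; omega
    simp [this]

lemma genBinom_pos (α : ℝ) (hα : -1 < α) (k : ℕ) : 0 < genBinom (k + α) k := by
  have hk := k.cast_nonneg (α := ℝ)
  exact div_pos (Real.Gamma_pos_of_pos (by linarith))
    (mul_pos (Real.Gamma_pos_of_pos (by linarith)) (Real.Gamma_pos_of_pos (by linarith)))

lemma genBinom_succ (α : ℝ) (hα : -1 < α) (k : ℕ) :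
    (k + 1) * genBinom (((k + 1 : ℕ) : ℝ) + α) (k + 1) = (k + 1 + α) * genBinom (k + α) k := by
  have hk := k.cast_nonneg (α := ℝ)
  have e1 : Real.Gamma (((k + 1 : ℕ) : ℝ) + 1) = (k + 1) * Real.Gamma (k + 1) := by
    push_cast
    exact Real.Gamma_add_one (by positivity)
  have e2 : Real.Gamma (((k + 1 : ℕ) : ℝ) + α + 1)
      = (k + 1 + α) * Real.Gamma (k + α + 1) := by
    rw [show ((k + 1 : ℕ) : ℝ) + α + 1 = (k + α + 1) + 1 by push_cast; ring,
      Real.Gamma_add_one (by linarith)]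
    ring
  have p1 : Real.Gamma ((k : ℝ) + 1) ≠ 0 := (Real.Gamma_pos_of_pos (by linarith)).ne'
  have p2 : Real.Gamma (α + 1) ≠ 0 := (Real.Gamma_pos_of_pos (by linarith)).ne'
  have p4 : (k : ℝ) + 1 ≠ 0 := by positivity
  unfold genBinom
  rw [e1, e2, show ((k + 1 : ℕ) : ℝ) + α - ((k + 1 : ℕ) : ℝ) + 1 = α + 1 by ring,
    show (k : ℝ) + α - k + 1 = α + 1 by ring]
  field_simp

lemma genBinom_zero (α : ℝ) (hα : -1 < α) : genBinom (((0 : ℕ) : ℝ) + α) 0 = 1 := by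
  have p2 : Real.Gamma (α + 1) ≠ 0 := (Real.Gamma_pos_of_pos (by linarith)).ne'
  simp [genBinom, p2]

lemma genBinom_le_genBinom {α β : ℝ} (hβ : -1 < β) (h : β ≤ α) (k : ℕ) :
    genBinom (k + β) k ≤ genBinom (k + α) k := by
  induction k with
  | zero => rw [genBinom_zero β hβ, genBinom_zero α (by linarith)]
  | succ k ih =>
    have hk := k.cast_nonneg (α := ℝ)
    have h1 := genBinom_succ β hβ k
    have h2 := genBinom_succ α (by linarith) k
    have h3 := genBinom_pos β hβ k
    refine le_of_mul_le_mul_left ?_ (show (0 : ℝ) < k + 1 by positivity)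
    rw [h1, h2]
    gcongr
    linarith

lemma genBinom_mul_sum_le {α β : ℝ} (hα : -1 < α) (h : α < β) (k : ℕ) :
    genBinom (k + α) k *
        (1 + (β - α) / (1 + |α|) * ∑ j ∈ Finset.range k, 1 / ((j : ℝ) + 1)) ≤
      genBinom (k + β) k := by
  induction k with
  | zero => simpa using (genBinom_zero α hα).trans_le (genBinom_zero β (by linarith)).ge
  | succ k ih =>
    have hk := k.cast_nonneg (α := ℝ)
    have h1 := genBinom_succ β (by linarith) k
    have h2 := genBinom_succ α hα k
    have ha := genBinom_pos α hα k
    set S := ∑ j ∈ Finset.range k, 1 / ((j : ℝ) + 1) with hS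
    have hS0 : 0 ≤ S := Finset.sum_nonneg fun j _ => by positivity
    set c := (β - α) / (1 + |α|) with hc
    have hc0 : 0 ≤ c := div_nonneg (by linarith) (by positivity)
    have hcβ : c * (1 + |α|) = β - α := div_mul_cancel₀ _ (by positivity)
    have hkα : (k : ℝ) + 1 + α ≤ (1 + |α|) * (k + 1) := by
      nlinarith [le_abs_self α, abs_nonneg α]
    have hinc : (k + 1 + α) * (c * (1 / ((k : ℝ) + 1))) ≤ β - α := by
      rw [← hcβ, mul_one_div, mul_div_assoc', div_le_iff₀ (by positivity)]
      nlinarith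
    refine le_of_mul_le_mul_left ?_ (show (0 : ℝ) < k + 1 by positivity)
    rw [h1, ← mul_assoc, h2, Finset.sum_range_succ, ← hS]
    calc (k + 1 + α) * genBinom (k + α) k * (1 + c * (S + 1 / ((k : ℝ) + 1)))
        = genBinom (k + α) k * ((k + 1 + α) * (1 + c * S)
            + (k + 1 + α) * (c * (1 / ((k : ℝ) + 1)))) := by ring
      _ ≤ genBinom (k + α) k * ((k + 1 + β) * (1 + c * S)) := by
          gcongr
          nlinarith [mul_nonneg hc0 hS0]
      _ = (k + 1 + β) * (genBinom (k + α) k * (1 + c * S)) := by ring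
      _ ≤ (k + 1 + β) * genBinom (k + β) k := by
          gcongr
          linarith

open Polynomial in
/-- The normalized Jacobi polynomial as an element of `ℝ[X]`. -/
noncomputable def jacobiRPoly (α β : ℝ) (k : ℕ) : ℝ[X] := C (jacobiP α β k 1)⁻¹ * jacobiPoly α β k

lemma eval_jacobiRPoly (α β : ℝ) (k : ℕ) (x : ℝ) :
    (jacobiRPoly α β k).eval x = jacobiR α β k x := by
  rw [jacobiRPoly, Polynomial.eval_C_mul, eval_jacobiPoly, jacobiR]
  ring

lemma jacobiR_one (α β : ℝ) (hα : -1 < α) (hβ : -1 < β) (k : ℕ) : jacobiR α β k 1 = 1 := by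
  rw [jacobiR, jacobiP_one α β hβ]
  exact div_self (genBinom_pos α hα k).ne'

lemma abs_jacobiR_neg_one (α β : ℝ) (hα : -1 < α) (hβ : -1 < β) (k : ℕ) :
    |jacobiR α β k (-1)| = genBinom (k + β) k / genBinom (k + α) k := by
  rw [jacobiR, jacobiP_one α β hβ, jacobiP_neg_one α β hα, abs_div, abs_mul,
    abs_of_pos (genBinom_pos α hα k), abs_of_pos (genBinom_pos β hβ k)]
  simp

/-- The Jacobi differential equation with eigenvalue `l`, imposed on a polynomial. -/
def JacobiODE (α β l : ℝ) (y : Polynomial ℝ) : Prop :=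
  ∀ x : ℝ, (1 - x ^ 2) * y.derivative.derivative.eval x
    + (β - α - (α + β + 2) * x) * y.derivative.eval x + l * y.eval x = 0

lemma jacobiODE_jacobiRPoly (α β : ℝ) (hα : -1 < α) (hβ : -1 < β) (k : ℕ) :
    JacobiODE α β (k * (k + α + β + 1)) (jacobiRPoly α β k) := by
  intro x
  simp only [jacobiRPoly, Polynomial.derivative_C_mul, Polynomial.eval_C_mul]
  linear_combination (jacobiP α β k 1)⁻¹ * jacobiPoly_ode α β hα hβ k x

/-- The Sonin function of a solution of the Jacobi differential equation. -/
noncomputable def sonin (l : ℝ) (y : Polynomial ℝ) (x : ℝ) : ℝ :=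
  y.eval x ^ 2 + (1 - x ^ 2) * y.derivative.eval x ^ 2 / l

lemma JacobiODE.hasDerivAt_sonin {α β l : ℝ} {y : Polynomial ℝ} (h : JacobiODE α β l y)
    (hl : l ≠ 0) (x : ℝ) :
    HasDerivAt (sonin l y)
      (2 * ((α - β) + (α + β + 1) * x) * y.derivative.eval x ^ 2 / l) x := by
  have hy := y.hasDerivAt x
  have hy' := y.derivative.hasDerivAt x
  have hx : HasDerivAt (fun x : ℝ => 1 - x ^ 2) (-(2 * x)) x := by
    simpa using (hasDerivAt_pow 2 x).const_sub 1
  refine ((hy.pow 2).add ((hx.mul (hy'.pow 2)).div_const l)).congr_deriv ?_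
  have := h x
  simp only [Pi.pow_apply]
  field_simp
  push_cast
  linear_combination (2 * y.derivative.eval x) * this

lemma JacobiODE.sonin_le_one {α β l : ℝ} {y : Polynomial ℝ} (h : JacobiODE α β l y)
    (hl : 0 < l) (hα : -(1 / 2) ≤ α) (h1 : |y.eval 1| ≤ 1) (h2 : |y.eval (-1)| ≤ 1)
    {x : ℝ} (hx : x ∈ Icc (-1 : ℝ) 1) : sonin l y x ≤ 1 := by
  have hcont : Continuous (sonin l y) :=
    continuous_iff_continuousAt.2 fun x => (h.hasDerivAt_sonin hl.ne' x).continuousAt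
  rcases le_or_gt 0 ((α - β) + (α + β + 1) * x) with hD | hD
  · have hmono : MonotoneOn (sonin l y) (Icc x 1) := by
      refine monotoneOn_of_hasDerivWithinAt_nonneg (convex_Icc _ _) hcont.continuousOn
        (fun z _ => (h.hasDerivAt_sonin hl.ne' z).hasDerivWithinAt) fun z hz => ?_
      rw [interior_Icc] at hz
      have : 0 ≤ (α - β) + (α + β + 1) * z := by
        have h3 : 0 ≤ (1 - x) * ((α - β) + (α + β + 1) * z) := by
          have e : (1 - x) * ((α - β) + (α + β + 1) * z) =
            (1 - z) * ((α - β) + (α + β + 1) * x) + (z - x) * (2 * α + 1) := by ring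
          rw [e]
          have := mul_nonneg (sub_nonneg.2 hz.2.le) hD
          have := mul_nonneg (sub_nonneg.2 hz.1.le) (show 0 ≤ 2 * α + 1 by linarith)
          linarith
        exact nonneg_of_mul_nonneg_right h3 (by linarith [hz.1, hz.2])
      positivity
    calc sonin l y x ≤ sonin l y 1 := hmono (left_mem_Icc.2 hx.2) (right_mem_Icc.2 hx.2) hx.2
      _ ≤ 1 := by simpa [sonin] using h1
  · have hanti : AntitoneOn (sonin l y) (Icc (-1) x) := by
      refine antitoneOn_of_hasDerivWithinAt_nonpos (convex_Icc _ _) hcont.continuousOn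
        (fun z _ => (h.hasDerivAt_sonin hl.ne' z).hasDerivWithinAt) fun z hz => ?_
      rw [interior_Icc] at hz
      have hx1 : 0 < 1 - x := by
        by_contra hx1
        have : x = 1 := by linarith [hx.2]
        subst this
        linarith
      have : (α - β) + (α + β + 1) * z ≤ 0 := by
        have h3 : 0 ≤ (1 - x) * -((α - β) + (α + β + 1) * z) := by
          have e : (1 - x) * -((α - β) + (α + β + 1) * z) =
            (1 - z) * -((α - β) + (α + β + 1) * x) + (x - z) * (2 * α + 1) := by ring
          rw [e]
          have := mul_nonneg (show 0 ≤ 1 - z by linarith [hz.2]) (neg_nonneg.2 hD.le)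
          have := mul_nonneg (sub_nonneg.2 hz.2.le) (show 0 ≤ 2 * α + 1 by linarith)
          linarith
        linarith [nonneg_of_mul_nonneg_right h3 hx1]
      rw [mul_div_assoc]
      exact mul_nonpos_of_nonpos_of_nonneg (by linarith) (by positivity)
    calc sonin l y x ≤ sonin l y (-1) :=
          hanti (left_mem_Icc.2 hx.1) (right_mem_Icc.2 hx.1) hx.1
      _ ≤ 1 := by simpa [sonin] using h2

lemma abs_eval_le_of_sonin_le_one {l : ℝ} {y : Polynomial ℝ} (hl : 0 < l) {x : ℝ}
    (hx : x ∈ Icc (-1 : ℝ) 1) (h : sonin l y x ≤ 1) : |y.eval x| ≤ 1 := by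
  have : 0 ≤ (1 - x ^ 2) * y.derivative.eval x ^ 2 / l := by
    have : 0 ≤ 1 - x ^ 2 := by nlinarith [hx.1, hx.2]
    positivity
  rw [← sq_le_one_iff_abs_le_one]
  unfold sonin at h
  linarith

lemma mul_derivative_le_sonin {l m : ℝ} {y : Polynomial ℝ} (hl : 0 < l) (hm : 0 < m) {x : ℝ}
    (hx : m ^ 2 ≤ l * (1 - x ^ 2)) :
    |y.eval x * y.derivative.eval x / l| ≤ sonin l y x / (2 * m) := by
  set a := y.eval x with ha
  set b := y.derivative.eval x with hb
  have hF : sonin l y x = a ^ 2 + (l * (1 - x ^ 2)) * (b / l) ^ 2 := by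
    simp only [sonin, ← ha, ← hb]
    field_simp
  have h1 : m ^ 2 * (b / l) ^ 2 ≤ (l * (1 - x ^ 2)) * (b / l) ^ 2 := by gcongr
  rw [mul_div_assoc, abs_le, le_div_iff₀ (by positivity), ← neg_div, div_le_iff₀ (by positivity),
    hF]
  constructor
  · nlinarith [sq_nonneg (a + m * (b / l))]
  · nlinarith [sq_nonneg (a - m * (b / l))]

lemma JacobiODE.hasDerivAt_corrected_sonin {α β l : ℝ} {y : Polynomial ℝ}
    (h : JacobiODE α β l y) (hl : l ≠ 0) {x : ℝ} (hx : 1 - x ^ 2 ≠ 0) :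
    HasDerivAt
      (fun x => sonin l y x -
        ((α - β) + (α + β + 1) * x) * (y.eval x * y.derivative.eval x / l))
      ((((α - β) + (α + β + 1) * x) * sonin l y x +
        (((α - β) + (α + β + 1) * x) * (β - α - (α + β + 2) * x) -
          (α + β + 1) * (1 - x ^ 2)) * (y.eval x * y.derivative.eval x / l)) / (1 - x ^ 2)) x := by
  have hy := y.hasDerivAt x
  have hy' := y.derivative.hasDerivAt x
  have hD : HasDerivAt (fun x : ℝ => (α - β) + (α + β + 1) * x) (α + β + 1) x := by
    simpa using ((hasDerivAt_id x).const_mul (α + β + 1)).const_add (α - β)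
  refine ((h.hasDerivAt_sonin hl x).sub (hD.mul ((hy.mul hy').div_const l))).congr_deriv ?_
  have := h x
  simp only [sonin, Pi.mul_apply]
  field_simp
  linear_combination (-((α - β) + (α + β + 1) * x) * y.eval x) * this

lemma JacobiODE.sonin_antitoneOn {α β l d : ℝ} {y : Polynomial ℝ} (h : JacobiODE α β l y)
    (hβ : -1 < β) (hα : α < -(1 / 2)) (hβα : β ≤ α) (hd : d = -(2 * α + 1)) (hl : 0 < l) :
    AntitoneOn (sonin l y) (Icc (1 - d) 1) := by
  have hcont : Continuous (sonin l y) :=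
    continuous_iff_continuousAt.2 fun x => (h.hasDerivAt_sonin hl.ne' x).continuousAt
  refine antitoneOn_of_hasDerivWithinAt_nonpos (convex_Icc _ _) hcont.continuousOn
    (fun z _ => (h.hasDerivAt_sonin hl.ne' z).hasDerivWithinAt) fun z hz => ?_
  rw [interior_Icc] at hz
  have : (α - β) + (α + β + 1) * z ≤ 0 := by nlinarith [hz.1, hz.2]
  rw [mul_div_assoc]
  exact mul_nonpos_of_nonpos_of_nonneg (by linarith) (by positivity)

lemma JacobiODE.sonin_le_of_bounded {α β l d M : ℝ} {y : Polynomial ℝ}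
    (h : JacobiODE α β l y) (hβ : -1 < β) (hα : α < -(1 / 2)) (hβα : β ≤ α)
    (hd : d = -(2 * α + 1)) (hl1 : 1 ≤ l) (hM : ∀ x ∈ Icc (-1 : ℝ) 1, |y.eval x| ≤ M) :
    sonin l y (1 - d / 2) ≤ M ^ 2 + (4 * M / d) ^ 2 := by
  have hl : 0 < l := by linarith
  have hd0 : 0 < d := by linarith
  have hd1 : d < 1 := by linarith
  have hanti := h.sonin_antitoneOn hβ hα hβα hd hl
  obtain ⟨z, hz, hz'⟩ := exists_hasDerivAt_eq_slope (fun x => y.eval x)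
    (fun x => y.derivative.eval x) (show 1 - d < 1 - d / 2 by linarith)
    y.continuous.continuousOn fun x _ => y.hasDerivAt x
  have hzM : |y.derivative.eval z| ≤ 4 * M / d := by
    have h1 := abs_le.1 (hM (1 - d) ⟨by linarith, by linarith⟩)
    have h2 := abs_le.1 (hM (1 - d / 2) ⟨by linarith, by linarith⟩)
    rw [hz', abs_div, abs_of_pos (show 0 < 1 - d / 2 - (1 - d) by linarith),
      div_le_div_iff₀ (by linarith) hd0]
    have : |y.eval (1 - d / 2) - y.eval (1 - d)| ≤ 2 * M := abs_le.2 ⟨by linarith, by linarith⟩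
    nlinarith
  calc sonin l y (1 - d / 2) ≤ sonin l y z :=
        hanti ⟨hz.1.le, by linarith [hz.2]⟩ ⟨by linarith, by linarith⟩ hz.2.le
    _ ≤ M ^ 2 + (4 * M / d) ^ 2 := by
        refine add_le_add ?_ ?_
        · exact sq_le_sq' (abs_le.1 (hM z ⟨by linarith [hz.1], by linarith [hz.2]⟩)).1
            (abs_le.1 (hM z ⟨by linarith [hz.1], by linarith [hz.2]⟩)).2
        · have h1 : y.derivative.eval z ^ 2 ≤ (4 * M / d) ^ 2 :=
            sq_le_sq' (abs_le.1 hzM).1 (abs_le.1 hzM).2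
          rw [div_le_iff₀ hl]
          calc (1 - z ^ 2) * y.derivative.eval z ^ 2 ≤ 1 * y.derivative.eval z ^ 2 := by
                gcongr
                nlinarith [sq_nonneg z]
            _ ≤ (4 * M / d) ^ 2 * l := by nlinarith [sq_nonneg (4 * M / d)]

lemma corrected_sonin_derivative_le {α β d x F t : ℝ} (hβ : -1 < β) (hβα : β ≤ α)
    (hα : α < -(1 / 2)) (hd : 0 < d) (hx0 : 0 ≤ x) (hx1 : 0 < 1 - x)
    (hDl : -1 ≤ (α - β) + (α + β + 1) * x) (hDu : (α - β) + (α + β + 1) * x ≤ -(d / 2))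
    (hF : 1 ≤ F) (ht : |t| ≤ d / 12 * F) :
    (((α - β) + (α + β + 1) * x) * F + (((α - β) + (α + β + 1) * x) *
      (β - α - (α + β + 2) * x) - (α + β + 1) * (1 - x ^ 2)) * t) / (1 - x ^ 2) ≤
      -(d / 8) / (1 - x) := by
  have he : 0 < 1 - x ^ 2 := by nlinarith
  have he2 : 1 - x ^ 2 ≤ 2 * (1 - x) := by nlinarith
  have hB : |β - α - (α + β + 2) * x| ≤ 2 := by
    rw [abs_le]; constructor <;> nlinarith
  generalize (α - β) + (α + β + 1) * x = D at *
  have hD1 : |D| ≤ 1 := abs_le.2 ⟨by linarith, by linarith⟩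
  have hs1 : |α + β + 1| ≤ 1 := abs_le.2 ⟨by linarith, by linarith⟩
  have he1 : |1 - x ^ 2| ≤ 1 := abs_le.2 ⟨by linarith, by nlinarith⟩
  have hK : |D * (β - α - (α + β + 2) * x) - (α + β + 1) * (1 - x ^ 2)| ≤ 3 := by
    calc _ ≤ |D * (β - α - (α + β + 2) * x)| + |(α + β + 1) * (1 - x ^ 2)| := abs_sub _ _
      _ = |D| * |β - α - (α + β + 2) * x| + |α + β + 1| * |1 - x ^ 2| := by
          rw [abs_mul, abs_mul]
      _ ≤ 1 * 2 + 1 * 1 := by gcongr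
      _ = 3 := by norm_num
  have hE : (D * (β - α - (α + β + 2) * x) - (α + β + 1) * (1 - x ^ 2)) * t ≤
      3 * (d / 12 * F) := by
    refine (le_abs_self _).trans ?_
    rw [abs_mul]
    gcongr
  have hDF : D * F ≤ -(d / 2) * F := by gcongr
  have hnum : D * F + (D * (β - α - (α + β + 2) * x) - (α + β + 1) * (1 - x ^ 2)) * t ≤
      -(d / 4) := by nlinarith
  rw [div_le_div_iff₀ he hx1]
  nlinarith [mul_le_mul_of_nonneg_right hnum hx1.le]

/-- For `β ≤ α < -1/2`, solutions of the Jacobi differential equation normalized at `1` cannot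
be bounded uniformly in the eigenvalue. -/
lemma JacobiODE.eventually_unbounded {α β : ℝ} (hβ : -1 < β) (hβα : β ≤ α)
    (hα : α < -(1 / 2)) (M : ℝ) :
    ∀ᶠ l : ℝ in atTop, ∀ y : Polynomial ℝ, JacobiODE α β l y → y.eval 1 = 1 →
      ¬ ∀ x ∈ Icc (-1 : ℝ) 1, |y.eval x| ≤ M := by
  obtain ⟨d, hd⟩ : ∃ d, d = -(2 * α + 1) := ⟨_, rfl⟩
  have hd0 : 0 < d := by linarith
  have hd1 : d < 1 := by linarith
  set m := 6 / d with hm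
  have hm0 : 0 < m := by positivity
  filter_upwards [eventually_ge_atTop 1, eventually_ge_atTop (m ^ 2 / (d / 2)),
    Real.tendsto_log_atTop.eventually_gt_atTop
      (Real.log (m ^ 2) + (2 * (M ^ 2 + (4 * M / d) ^ 2) - d / 8 * Real.log (d / 2)) / (d / 8))]
    with l hl1 hlm hlog y h hy1 hM
  have hl : 0 < l := by linarith
  have hanti := h.sonin_antitoneOn hβ hα hβα hd hl
  have hF1 : ∀ x ∈ Icc (1 - d) 1, 1 ≤ sonin l y x := fun x hx => by
    calc (1 : ℝ) = sonin l y 1 := by simp [sonin, hy1]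
      _ ≤ sonin l y x := hanti hx ⟨by linarith, le_rfl⟩ hx.2
  have hFx := h.sonin_le_of_bounded hβ hα hβα hd hl1 hM
  have hml : m ^ 2 / l ≤ d / 2 := by
    rw [div_le_iff₀ (by positivity)] at hlm
    rw [div_le_iff₀ hl]
    linarith
  have hml0 : 0 < m ^ 2 / l := by positivity
  have hsub : ∀ x ∈ Icc (1 - d / 2) (1 - m ^ 2 / l), 1 - x ≤ 1 - x ^ 2 ∧
      m ^ 2 ≤ l * (1 - x ^ 2) ∧ 0 < 1 - x ∧ x ∈ Icc (1 - d) 1 := by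
    intro x hx
    have h0 : 0 ≤ x := by linarith [hx.1]
    have h2 : m ^ 2 ≤ (1 - x) * l := (div_le_iff₀ hl).1 (by linarith [hx.2])
    have h3 : 0 < 1 - x := by linarith [hx.2]
    refine ⟨by nlinarith, ?_, h3, by linarith [hx.1], by linarith⟩
    nlinarith [mul_nonneg h0 (mul_nonneg h3.le hl.le)]
  have hyy : ∀ x ∈ Icc (1 - d / 2) (1 - m ^ 2 / l),
      |y.eval x * y.derivative.eval x / l| ≤ d / 12 * sonin l y x := by
    intro x hx
    refine (mul_derivative_le_sonin hl hm0 (hsub x hx).2.1).trans_eq ?_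
    rw [hm]
    field_simp
    ring
  set G : ℝ → ℝ := fun x => sonin l y x -
        ((α - β) + (α + β + 1) * x) * (y.eval x * y.derivative.eval x / l) with hG
  have hD : ∀ x ∈ Icc (1 - d / 2) (1 - m ^ 2 / l),
      -d ≤ (α - β) + (α + β + 1) * x ∧ (α - β) + (α + β + 1) * x ≤ -(d / 2) := by
    intro x hx
    constructor <;> nlinarith [hx.1, hx.2]
  have hGF : ∀ x ∈ Icc (1 - d / 2) (1 - m ^ 2 / l), 0 ≤ G x ∧ G x ≤ 2 * sonin l y x := by
    intro x hx
    have h1 := hF1 x (hsub x hx).2.2.2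
    have h2 : |((α - β) + (α + β + 1) * x) * (y.eval x * y.derivative.eval x / l)| ≤
        1 * (d / 12 * sonin l y x) := by
      rw [abs_mul]
      gcongr
      · exact abs_le.2 ⟨by linarith [(hD x hx).1], by linarith [(hD x hx).2]⟩
      · exact hyy x hx
    have h3 := abs_le.1 h2
    constructor <;> simp only [hG] <;> nlinarith
  have hGanti : AntitoneOn (fun x => G x - d / 8 * Real.log (1 - x))
      (Icc (1 - d / 2) (1 - m ^ 2 / l)) := by
    have hder : ∀ x ∈ Icc (1 - d / 2) (1 - m ^ 2 / l),
        HasDerivAt (fun x => G x - d / 8 * Real.log (1 - x)) _ x := fun x hx =>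
      (h.hasDerivAt_corrected_sonin hl.ne' (by linarith [hsub x hx])).sub
        ((((hasDerivAt_id x).const_sub 1).log (hsub x hx).2.2.1.ne').const_mul (d / 8))
    refine antitoneOn_of_hasDerivWithinAt_nonpos (convex_Icc _ _)
      (fun x hx => (hder x hx).continuousAt.continuousWithinAt)
      (fun x hx => (hder x (interior_subset hx)).hasDerivWithinAt) fun x hx => ?_
    replace hx := interior_subset hx
    obtain ⟨-, -, h5, h6⟩ := hsub x hx
    have hq := corrected_sonin_derivative_le hβ hβα hα hd0 (by linarith [hx.1]) h5
      (by linarith [(hD x hx).1]) (hD x hx).2 (hF1 x h6) (hyy x hx)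
    simp only [id]
    calc _ ≤ -(d / 8) / (1 - x) - d / 8 * (-1 / (1 - x)) := by gcongr
      _ = 0 := by ring
      _ ≤ 0 := le_rfl
  have hle : 1 - d / 2 ≤ 1 - m ^ 2 / l := by linarith
  have hend := hGanti (left_mem_Icc.2 hle) (right_mem_Icc.2 hle) hle
  simp only [sub_sub_cancel] at hend
  have hg0 := (hGF _ (right_mem_Icc.2 hle)).1
  have hg1 := (hGF _ (left_mem_Icc.2 hle)).2
  rw [Real.log_div (by positivity) hl.ne'] at hend
  have : (2 * (M ^ 2 + (4 * M / d) ^ 2) - d / 8 * Real.log (d / 2)) <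
      (Real.log l - Real.log (m ^ 2)) * (d / 8) := by
    rw [← div_lt_iff₀ (by positivity)]
    linarith
  nlinarith

lemma tendsto_setIntegral_of_tendsto_setIntegral_Iic {μ : Measure ℝ} [IsFiniteMeasure μ]
    {φ : ℕ → ℝ → ℝ} (hφ : ∀ k, Measurable (φ k)) (hb : ∀ k x, |φ k x| ≤ 1)
    (huniv : Tendsto (fun k => ∫ x, φ k x ∂μ) atTop (nhds 0))
    (hIic : ∀ c, Tendsto (fun k => ∫ x in Iic c, φ k x ∂μ) atTop (nhds 0))
    {s : Set ℝ} (hs : MeasurableSet s) :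
    Tendsto (fun k => ∫ x in s, φ k x ∂μ) atTop (nhds 0) := by
  have hint : ∀ k, Integrable (φ k) μ := fun k =>
    Integrable.of_bound (hφ k).aestronglyMeasurable 1 (.of_forall (hb k))
  refine MeasurableSpace.induction_on_inter
    (C := fun s _ => Tendsto (fun k => ∫ x in s, φ k x ∂μ) atTop (nhds 0))
    ((BorelSpace.measurable_eq (α := ℝ)).trans (borel_eq_generateFrom_Iic ℝ)) isPiSystem_Iic
    ?_ ?_ ?_ ?_ s hs
  · simp
  · rintro _ ⟨c, rfl⟩
    exact hIic c
  · intro t ht h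
    simp only [fun k => setIntegral_compl ht (hint k)]
    simpa using huniv.sub h
  · intro t hd hm h
    simp only [fun k => ((hasSum_integral_iUnion hm hd (hint k).integrableOn).tsum_eq).symm]
    rw [← tsum_zero (α := ℝ) (β := ℕ)]
    refine tendsto_tsum_of_dominated_convergence (summable_measure_toReal (μ := μ) hm hd) h
      (.of_forall fun k i => ?_)
    simpa using norm_setIntegral_le_of_norm_le_const (f := φ k) (C := 1) (measure_lt_top μ (t i))
      fun x _ => hb k x

lemma tendsto_integral_mul_of_tendsto_setIntegral_Iic {μ : Measure ℝ} [IsFiniteMeasure μ]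
    {φ : ℕ → ℝ → ℝ} (hφ : ∀ k, Measurable (φ k)) (hb : ∀ k x, |φ k x| ≤ 1)
    (huniv : Tendsto (fun k => ∫ x, φ k x ∂μ) atTop (nhds 0))
    (hIic : ∀ c, Tendsto (fun k => ∫ x in Iic c, φ k x ∂μ) atTop (nhds 0))
    {f : ℝ → ℝ} (hf : Integrable f μ) :
    Tendsto (fun k => ∫ x, f x * φ k x ∂μ) atTop (nhds 0) := by
  have hmul : ∀ k {f : ℝ → ℝ}, Integrable f μ → Integrable (fun x => f x * φ k x) μ :=
    fun k f hf => hf.mul_bdd (hφ k).aestronglyMeasurable (.of_forall (hb k))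
  refine Integrable.induction
    (fun f => Tendsto (fun k => ∫ x, f x * φ k x ∂μ) atTop (nhds 0)) ?_ ?_ ?_ ?_ hf
  · intro c s hs _
    have h := (tendsto_setIntegral_of_tendsto_setIntegral_Iic hφ hb huniv hIic hs).const_mul c
    rw [mul_zero] at h
    refine h.congr fun k => ?_
    rw [← integral_const_mul, ← integral_indicator hs]
    refine integral_congr_ae (.of_forall fun x => ?_)
    by_cases hx : x ∈ s <;> simp [hx]
  · intro f g _ hf hg hPf hPg
    simp only [Pi.add_apply, add_mul, fun k => integral_add (hmul k hf) (hmul k hg)]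
    simpa using hPf.add hPg
  · refine isClosed_of_closure_subset fun f hf => ?_
    rw [mem_ofPred_eq, Metric.tendsto_atTop]
    intro ε hε
    obtain ⟨g, hg, hfg⟩ := Metric.mem_closure_iff.1 hf (ε / 2) (by positivity)
    obtain ⟨N, hN⟩ := Metric.tendsto_atTop.1 hg (ε / 2) (by positivity)
    refine ⟨N, fun k hk => ?_⟩
    have h1 := hN k hk
    rw [dist_zero_right] at h1 ⊢
    have hfi := L1.integrable_coeFn f
    have hgi := L1.integrable_coeFn g
    have h2 : ‖∫ x, (f x - g x) * φ k x ∂μ‖ ≤ dist f g := by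
      rw [dist_eq_norm, L1.norm_eq_integral_norm]
      refine norm_integral_le_of_norm_le (L1.integrable_coeFn (f - g)).norm ?_
      filter_upwards [Lp.coeFn_sub f g] with x hx
      rw [hx, norm_mul]
      exact mul_le_of_le_one_right (norm_nonneg _) (hb k x)
    have h3 : ∫ x, f x * φ k x ∂μ = ∫ x, (f x - g x) * φ k x ∂μ + ∫ x, g x * φ k x ∂μ := by
      simp only [sub_mul]
      rw [integral_sub (hmul k hfi) (hmul k hgi), sub_add_cancel]
    rw [h3]
    calc _ ≤ ‖∫ x, (f x - g x) * φ k x ∂μ‖ + ‖∫ x, g x * φ k x ∂μ‖ := norm_add_le _ _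
      _ < ε / 2 + ε / 2 := by linarith
      _ = ε := by ring
  · intro f g hfg _ h
    refine h.congr fun k => integral_congr_ae ?_
    filter_upwards [hfg] with x hx
    rw [hx]

/-- Banach–Steinhaus on `L¹`: multipliers with pointwise convergent integrals are uniformly
bounded. -/
lemma exists_ae_bound_of_tendsto_integral_mul {μ : Measure ℝ} [IsFiniteMeasure μ]
    {φ : ℕ → ℝ → ℝ} (hφ : ∀ k, Measurable (φ k)) {B : ℕ → ℝ} (hb : ∀ k x, |φ k x| ≤ B k)
    (h : ∀ f : ℝ → ℝ, Integrable f μ → Tendsto (fun k => ∫ x, f x * φ k x ∂μ) atTop (nhds 0)) :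
    ∃ M, ∀ k, ∀ᵐ x ∂μ, |φ k x| ≤ M := by
  have hmul : ∀ k {f : ℝ → ℝ}, Integrable f μ → Integrable (fun x => f x * φ k x) μ :=
    fun k f hf => hf.mul_bdd (hφ k).aestronglyMeasurable (.of_forall (hb k))
  have hint : ∀ k, Integrable (φ k) μ := fun k =>
    Integrable.of_bound (hφ k).aestronglyMeasurable (B k) (.of_forall (hb k))
  let T : ℕ → (Lp ℝ 1 μ →L[ℝ] ℝ) := fun k =>
    LinearMap.mkContinuous
      { toFun := fun f => ∫ x, f x * φ k x ∂μ
        map_add' := fun f g => by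
          rw [← integral_add (hmul k (L1.integrable_coeFn f)) (hmul k (L1.integrable_coeFn g))]
          refine integral_congr_ae ?_
          filter_upwards [Lp.coeFn_add f g] with x hx
          rw [hx, Pi.add_apply, add_mul]
        map_smul' := fun c f => by
          rw [RingHom.id_apply, smul_eq_mul, ← integral_const_mul]
          refine integral_congr_ae ?_
          filter_upwards [Lp.coeFn_smul c f] with x hx
          rw [hx, Pi.smul_apply, smul_eq_mul, mul_assoc] }
      (B k) fun f => by
        change ‖∫ x, f x * φ k x ∂μ‖ ≤ _
        rw [L1.norm_eq_integral_norm, ← integral_const_mul]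
        refine norm_integral_le_of_norm_le ((L1.integrable_coeFn f).norm.const_mul _)
          (.of_forall fun x => ?_)
        rw [norm_mul, mul_comm]
        exact mul_le_mul_of_nonneg_right (hb k x) (norm_nonneg _)
  have hT : ∀ k f, T k f = ∫ x, f x * φ k x ∂μ := fun _ _ => rfl
  obtain ⟨M, hM⟩ := banach_steinhaus (g := T) fun f => by
    obtain ⟨C, hC⟩ := (Metric.isBounded_range_of_tendsto _
      (h f (L1.integrable_coeFn f))).exists_norm_le
    exact ⟨C, fun k => hC _ ⟨k, rfl⟩⟩
  refine ⟨M, fun k => ?_⟩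
  have hset : ∀ s, MeasurableSet s → |∫ x in s, φ k x ∂μ| ≤ M * μ.real s := by
    intro s hs
    have h1 := (T k).le_of_opNorm_le (hM k) (indicatorConstLp 1 hs (measure_ne_top μ s) (1 : ℝ))
    rw [hT, norm_indicatorConstLp one_ne_zero ENNReal.one_ne_top] at h1
    have h2 : ∫ x, indicatorConstLp 1 hs (measure_ne_top μ s) (1 : ℝ) x * φ k x ∂μ =
        ∫ x in s, φ k x ∂μ := by
      rw [← integral_indicator hs]
      refine integral_congr_ae ?_
      filter_upwards [indicatorConstLp_coeFn (p := 1) (hs := hs) (hμs := measure_ne_top μ s)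
        (c := (1 : ℝ))] with x hx
      rw [hx]
      by_cases hxs : x ∈ s <;> simp [hxs]
    rw [h2] at h1
    simpa using h1
  have hu : φ k ≤ᵐ[μ] fun _ => M :=
    ae_le_of_forall_setIntegral_le (hint k) (integrable_const M) fun s hs _ => by
      rw [setIntegral_const, smul_eq_mul, mul_comm]
      exact (abs_le.1 (hset s hs)).2
  have hl : (fun _ => -M) ≤ᵐ[μ] φ k :=
    ae_le_of_forall_setIntegral_le (integrable_const (-M)) (hint k) fun s hs _ => by
      rw [setIntegral_const, smul_eq_mul, mul_comm, neg_mul]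
      exact (abs_le.1 (hset s hs)).1
  filter_upwards [hu, hl] with x h1 h2 using abs_le.2 ⟨h2, h1⟩

lemma intervalIntegrable_jacobiWeight_left (α β : ℝ) (hα : -1 < α) :
    IntervalIntegrable (jacobiWeight α β) volume 0 (Real.pi / 2) := by
  have hpi := Real.pi_pos
  rw [intervalIntegrable_iff_integrableOn_Ioc_of_le (by positivity)]
  have hsin : ∀ x ∈ Ioo 0 (Real.pi / 2), 0 < Real.sin (x / 2) := fun x hx =>
    Real.sin_pos_of_pos_of_lt_pi (by linarith [hx.1]) (by linarith [hx.2])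
  have hcos : ∀ x ∈ Icc 0 (Real.pi / 2), 0 < Real.cos (x / 2) := fun x hx =>
    Real.cos_pos_of_mem_Ioo ⟨by linarith [hx.1], by linarith [hx.2]⟩
  have h1 : IntegrableOn
      (fun x => (α + 1) * (Real.sin (x / 2) ^ (2 * α + 1) * Real.cos (x / 2)))
      (Ioc 0 (Real.pi / 2)) := by
    refine intervalIntegral.integrableOn_deriv_of_nonneg
      (g := fun x => Real.sin (x / 2) ^ (2 * α + 2)) ?_ (fun x hx => ?_) (fun x hx => ?_)
    · exact ContinuousOn.rpow_const (by fun_prop) fun x _ => Or.inr (by linarith)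
    · refine (((hasDerivAt_id x).div_const 2).sin.rpow_const (p := 2 * α + 2)
        (Or.inl (hsin x hx).ne')).congr_deriv ?_
      simp only [id]
      rw [show 2 * α + 2 - 1 = 2 * α + 1 by ring]
      ring
    · have := hsin x hx
      have := hcos x (Ioo_subset_Icc_self hx)
      have : 0 ≤ α + 1 := by linarith
      positivity
  have h2 : ContinuousOn (fun x => Real.cos (x / 2) ^ (2 * β) / (α + 1))
      (Icc 0 (Real.pi / 2)) := by
    refine ContinuousOn.div_const (ContinuousOn.rpow_const (by fun_prop) fun x hx => ?_) _
    exact Or.inl (hcos x hx).ne'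
  have h3 := (((integrableOn_Icc_iff_integrableOn_Ioc enorm_ne_top).2 h1).mul_continuousOn h2 isCompact_Icc)
  refine (h3.congr_fun (fun x hx => ?_) measurableSet_Icc).mono_set Ioc_subset_Icc_self
  have hc := hcos x hx
  have ha : α + 1 ≠ 0 := by linarith
  simp only [jacobiWeight]
  rw [Real.rpow_add_one hc.ne']
  field_simp

lemma integrableOn_jacobiWeight (α β : ℝ) (hα : -1 < α) (hβ : -1 < β) :
    IntegrableOn (jacobiWeight α β) (Ioc 0 Real.pi) := by
  have hpi := Real.pi_pos
  rw [← intervalIntegrable_iff_integrableOn_Ioc_of_le hpi.le]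
  refine (intervalIntegrable_jacobiWeight_left α β hα).trans ?_
  have h := (intervalIntegrable_jacobiWeight_left β α hβ).comp_sub_left Real.pi
  rw [sub_zero, show Real.pi - Real.pi / 2 = Real.pi / 2 by ring] at h
  refine h.symm.congr fun x _ => ?_
  simp only [jacobiWeight]
  rw [show (Real.pi - x) / 2 = Real.pi / 2 - x / 2 by ring, Real.sin_pi_div_two_sub,
    Real.cos_pi_div_two_sub, mul_comm]

lemma measurable_jacobiWeight (α β : ℝ) : Measurable (jacobiWeight α β) := by
  unfold jacobiWeight
  fun_prop

lemma jacobiWeight_nonneg (α β : ℝ) {x : ℝ} (hx : x ∈ Ioc 0 Real.pi) :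
    0 ≤ jacobiWeight α β x :=
  mul_nonneg
    (Real.rpow_nonneg (Real.sin_nonneg_of_nonneg_of_le_pi (by linarith [hx.1])
      (by linarith [hx.1, hx.2])) _)
    (Real.rpow_nonneg (Real.cos_nonneg_of_mem_Icc ⟨by linarith [hx.1, Real.pi_pos],
      by linarith [hx.2]⟩) _)

lemma sin_half_pos {x : ℝ} (hx : x ∈ Ioo 0 Real.pi) : 0 < Real.sin (x / 2) :=
  Real.sin_pos_of_pos_of_lt_pi (by linarith [hx.1]) (by linarith [hx.1, hx.2])

lemma cos_half_pos {x : ℝ} (hx : x ∈ Ioo 0 Real.pi) : 0 < Real.cos (x / 2) :=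
  Real.cos_pos_of_mem_Ioo ⟨by linarith [hx.1, Real.pi_pos], by linarith [hx.2]⟩

lemma jacobiWeight_pos (α β : ℝ) {x : ℝ} (hx : x ∈ Ioo 0 Real.pi) :
    0 < jacobiWeight α β x :=
  mul_pos (Real.rpow_pos_of_pos (sin_half_pos hx) _) (Real.rpow_pos_of_pos (cos_half_pos hx) _)

lemma cos_eq_half (x : ℝ) : Real.cos x = Real.cos (x / 2) ^ 2 - Real.sin (x / 2) ^ 2 := by
  rw [← Real.cos_two_mul']
  congr 1
  ring

lemma sin_eq_half (x : ℝ) : Real.sin x = 2 * Real.sin (x / 2) * Real.cos (x / 2) := by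
  rw [← Real.sin_two_mul]
  congr 1
  ring

/-- The self-adjoint form of the Jacobi differential equation in the variable `θ`. -/
lemma JacobiODE.hasDerivAt_selfAdjoint {α β l : ℝ} {y : Polynomial ℝ} (h : JacobiODE α β l y)
    {x : ℝ} (hx : x ∈ Ioo 0 Real.pi) :
    HasDerivAt (fun x => Real.sin (x / 2) ^ (2 * α + 2) * Real.cos (x / 2) ^ (2 * β + 2) *
        y.derivative.eval (Real.cos x))
      (l / 2 * (y.eval (Real.cos x) * jacobiWeight α β x)) x := by
  have hs := sin_half_pos hx
  have hc := cos_half_pos hx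
  have h2 := (hasDerivAt_id x).div_const 2
  refine (((h2.sin.rpow_const (p := 2 * α + 2) (Or.inl hs.ne')).mul
    (h2.cos.rpow_const (p := 2 * β + 2) (Or.inl hc.ne'))).mul
    ((y.derivative.hasDerivAt (Real.cos x)).comp x (Real.hasDerivAt_cos x))).congr_deriv ?_
  have hode := h (Real.cos x)
  simp only [id, jacobiWeight, Function.comp, Pi.mul_apply]
  rw [show 2 * α + 2 - 1 = 2 * α + 1 by ring, show 2 * β + 2 - 1 = 2 * β + 1 by ring,
    show 2 * α + 2 = (2 * α + 1) + 1 by ring, show 2 * β + 2 = (2 * β + 1) + 1 by ring,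
    Real.rpow_add_one hs.ne' (2 * α + 1), Real.rpow_add_one hc.ne' (2 * β + 1), sin_eq_half x]
  have hsc : Real.sin (x / 2) ^ 2 + Real.cos (x / 2) ^ 2 = 1 := Real.sin_sq_add_cos_sq _
  have hcx := cos_eq_half x
  generalize Polynomial.eval (Real.cos x) y.derivative.derivative = y2 at *
  generalize Polynomial.eval (Real.cos x) y.derivative = y1 at *
  generalize Polynomial.eval (Real.cos x) y = y0 at *
  generalize Real.sin (x / 2) ^ (2 * α + 1) = S at *
  generalize Real.cos (x / 2) ^ (2 * β + 1) = K at *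
  rw [hcx] at hode
  generalize Real.sin (x / 2) = s at *
  generalize Real.cos (x / 2) = c at *
  have hc2 : c ^ 2 = 1 - s ^ 2 := by linarith
  have e : 1 - (c ^ 2 - s ^ 2) ^ 2 = 4 * s ^ 2 * c ^ 2 := by rw [hc2]; ring
  have e2 : β - α - (α + β + 2) * (c ^ 2 - s ^ 2) = 2 * ((β + 1) * s ^ 2 - (α + 1) * c ^ 2) := by
    rw [hc2]; ring
  rw [e, e2] at hode
  linear_combination (-(1 / 2) * S * K) * hode

lemma JacobiODE.integral_eq {α β l : ℝ} {y : Polynomial ℝ} (hα : -1 < α) (hβ : -1 < β)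
    (h : JacobiODE α β l y) (hl : l ≠ 0) {c : ℝ} (hc0 : 0 ≤ c) (hc : c ≤ Real.pi) :
    ∫ x in Ioc 0 c, y.eval (Real.cos x) * jacobiWeight α β x =
      2 / l * (Real.sin (c / 2) ^ (2 * α + 2) * Real.cos (c / 2) ^ (2 * β + 2) *
        y.derivative.eval (Real.cos c)) := by
  have hint : IntervalIntegrable (fun x => l / 2 * (y.eval (Real.cos x) * jacobiWeight α β x))
      volume 0 c := by
    rw [intervalIntegrable_iff_integrableOn_Ioc_of_le hc0]
    have h1 := ((integrableOn_Icc_iff_integrableOn_Ioc enorm_ne_top).2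
      (integrableOn_jacobiWeight α β hα hβ)).continuousOn_mul
      (g := fun x => y.eval (Real.cos x)) (by fun_prop) isCompact_Icc
    exact (h1.mono_set (Ioc_subset_Icc_self.trans (Icc_subset_Icc_right hc))).const_mul _
  have hft := intervalIntegral.integral_eq_sub_of_hasDerivAt_of_le hc0
    (f := fun x => Real.sin (x / 2) ^ (2 * α + 2) * Real.cos (x / 2) ^ (2 * β + 2) *
        y.derivative.eval (Real.cos x))
    (((ContinuousOn.rpow_const (by fun_prop) fun x _ => Or.inr (by linarith)).mul
      (ContinuousOn.rpow_const (by fun_prop) fun x _ => Or.inr (by linarith))).mul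
      (by fun_prop))
    (fun x hx => h.hasDerivAt_selfAdjoint ⟨hx.1, hx.2.trans_le hc⟩) hint
  have h0 : (0 : ℝ) ^ (2 * α + 2) = 0 := Real.zero_rpow (by linarith)
  rw [intervalIntegral.integral_of_le hc0, integral_const_mul] at hft
  simp only [zero_div, Real.sin_zero, h0, zero_mul, sub_zero] at hft
  rw [← hft]
  field_simp

lemma abs_sin_mul_derivative_le {l : ℝ} {y : Polynomial ℝ} (hl : 0 < l) {c : ℝ}
    (h : sonin l y (Real.cos c) ≤ 1) :
    |Real.sin c * y.derivative.eval (Real.cos c)| ≤ √l := by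
  refine Real.abs_le_sqrt ?_
  unfold sonin at h
  rw [← Real.sin_sq] at h
  have h1 : Real.sin c ^ 2 * y.derivative.eval (Real.cos c) ^ 2 / l ≤ 1 := by
    nlinarith [sq_nonneg (y.eval (Real.cos c))]
  rw [mul_pow]
  simpa using (div_le_iff₀ hl).1 h1

/-- The eigenvalue attached to the Jacobi polynomial of degree `k + 1`. -/
noncomputable def jacobiEigenvalue (α β : ℝ) (k : ℕ) : ℝ :=
  ((k + 1 : ℕ) : ℝ) * (((k + 1 : ℕ) : ℝ) + α + β + 1)

lemma jacobiEigenvalue_pos {α β : ℝ} (hα : -1 < α) (hβ : -1 < β) (k : ℕ) :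
    0 < jacobiEigenvalue α β k := by
  have := k.cast_nonneg (α := ℝ)
  refine mul_pos (by positivity) ?_
  push_cast
  linarith

lemma tendsto_jacobiEigenvalue {α β : ℝ} (hα : -1 < α) (hβ : -1 < β) :
    Tendsto (jacobiEigenvalue α β) atTop atTop := by
  refine Tendsto.atTop_mul_atTop₀ ?_ ?_
  · exact tendsto_natCast_atTop_atTop.comp (tendsto_add_atTop_nat 1)
  · refine tendsto_atTop_mono (f := fun k : ℕ => (k : ℝ)) (fun k => ?_)
      tendsto_natCast_atTop_atTop
    push_cast
    linarith

lemma sonin_jacobiRPoly_le_one {α β : ℝ} (hβ : -1 < β) (hβα : β ≤ α) (hα : -(1 / 2) ≤ α)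
    (k : ℕ) {x : ℝ} (hx : x ∈ Icc (-1 : ℝ) 1) :
    sonin (jacobiEigenvalue α β k) (jacobiRPoly α β (k + 1)) x ≤ 1 := by
  have hα' : -1 < α := by linarith
  refine (jacobiODE_jacobiRPoly α β hα' hβ (k + 1)).sonin_le_one
    (jacobiEigenvalue_pos hα' hβ k) hα ?_ ?_ hx
  · rw [eval_jacobiRPoly, jacobiR_one α β hα' hβ, abs_one]
  · rw [eval_jacobiRPoly, abs_jacobiR_neg_one α β hα' hβ]
    exact div_le_one_of_le₀ (genBinom_le_genBinom hβ hβα _) (genBinom_pos α hα' _).le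

lemma tendsto_setIntegral_jacobiR {α β : ℝ} (hβ : -1 < β) (hβα : β ≤ α) (hα : -(1 / 2) ≤ α)
    {c : ℝ} (hc0 : 0 ≤ c) (hc : c ≤ Real.pi) :
    Tendsto (fun k : ℕ =>
      ∫ x in Ioc 0 c, jacobiR α β (k + 1) (Real.cos x) * jacobiWeight α β x) atTop (nhds 0) := by
  have hα' : -1 < α := by linarith
  simp only [← eval_jacobiRPoly]
  have hI := fun k : ℕ => (jacobiODE_jacobiRPoly α β hα' hβ (k + 1)).integral_eq hα' hβ
    (jacobiEigenvalue_pos hα' hβ k).ne' hc0 hc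
  simp only [hI]
  rcases hc0.eq_or_lt with rfl | hc0
  · simp [Real.zero_rpow (show 2 * α + 2 ≠ 0 by linarith)]
  rcases hc.eq_or_lt with rfl | hc
  · simp [Real.zero_rpow (show 2 * β + 2 ≠ 0 by linarith)]
  have hs := Real.sin_pos_of_pos_of_lt_pi hc0 hc
  set p := Real.sin (c / 2) ^ (2 * α + 2) * Real.cos (c / 2) ^ (2 * β + 2) with hp
  have hp0 : 0 ≤ p := mul_nonneg (Real.rpow_nonneg (sin_half_pos ⟨hc0, hc⟩).le _)
    (Real.rpow_nonneg (cos_half_pos ⟨hc0, hc⟩).le _)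
  have hlim : Tendsto (fun k => 2 * p / Real.sin c * (√(jacobiEigenvalue α β k))⁻¹) atTop
      (nhds 0) := by
    rw [← mul_zero (2 * p / Real.sin c)]
    exact (tendsto_inv_atTop_zero.comp
      (Real.tendsto_sqrt_atTop.comp (tendsto_jacobiEigenvalue hα' hβ))).const_mul _
  refine squeeze_zero_norm (fun k => ?_) hlim
  have hl := jacobiEigenvalue_pos hα' hβ k
  have hd := abs_sin_mul_derivative_le hl
    (sonin_jacobiRPoly_le_one hβ hβα hα k ⟨Real.neg_one_le_cos c, Real.cos_le_one c⟩)
  rw [abs_mul, abs_of_pos hs] at hd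
  have hd' : |(jacobiRPoly α β (k + 1)).derivative.eval (Real.cos c)| ≤
      √(jacobiEigenvalue α β k) / Real.sin c := by
    rw [le_div_iff₀ hs]
    linarith
  change ‖2 / jacobiEigenvalue α β k * _‖ ≤ _
  rw [Real.norm_eq_abs, abs_mul, abs_mul, abs_of_pos (div_pos two_pos hl), abs_of_nonneg hp0]
  calc _ ≤ 2 / jacobiEigenvalue α β k * (p * (√(jacobiEigenvalue α β k) / Real.sin c)) := by
        gcongr
    _ = _ := by
        have hsq := Real.sq_sqrt hl.le
        have hr := Real.sqrt_pos.2 hl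
        nth_rewrite 1 [← hsq]
        field_simp

/-- Sufficiency: the Riemann–Lebesgue lemma holds on the set `S`. -/
lemma tendsto_fourierJacobi {α β : ℝ} (hβ : -1 < β) (hβα : β ≤ α) (hα : -(1 / 2) ≤ α)
    {f : ℝ → ℝ} (hf : MemJacobiL α β f) :
    Tendsto (fun k : ℕ => fourierJacobi α β f k) atTop (nhds 0) := by
  have hα' : -1 < α := by linarith
  rw [← tendsto_add_atTop_iff_nat 1]
  set w : ℝ → NNReal := fun x => (jacobiWeight α β x).toNNReal with hw
  have hwm : Measurable w := (measurable_jacobiWeight α β).real_toNNReal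
  set μ : Measure ℝ := (volume.restrict (Ioc 0 Real.pi)).withDensity fun x => (w x : ENNReal)
    with hμ
  have : IsFiniteMeasure μ :=
    isFiniteMeasure_withDensity_ofReal (integrableOn_jacobiWeight α β hα' hβ).2
  have hwx : ∀ x ∈ Ioc 0 Real.pi, ∀ g : ℝ, w x • g = g * jacobiWeight α β x := by
    intro x hx g
    rw [NNReal.smul_def, Real.coe_toNNReal _ (jacobiWeight_nonneg α β hx), smul_eq_mul, mul_comm]
  set φ : ℕ → ℝ → ℝ := fun k x => jacobiR α β (k + 1) (Real.cos x) with hφ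
  have hcont : ∀ k, Continuous (φ k) := fun k => by
    simp only [hφ, ← eval_jacobiRPoly]
    fun_prop
  have hb : ∀ k x, |φ k x| ≤ 1 := fun k x => by
    have hx : Real.cos x ∈ Icc (-1 : ℝ) 1 := ⟨Real.neg_one_le_cos x, Real.cos_le_one x⟩
    simp only [hφ, ← eval_jacobiRPoly]
    exact abs_eval_le_of_sonin_le_one (jacobiEigenvalue_pos hα' hβ k) hx
      (sonin_jacobiRPoly_le_one hβ hβα hα k hx)
  have hI : ∀ k c, ∫ x in Iic c, φ k x ∂μ =
      ∫ x in Ioc 0 (max 0 (min c Real.pi)), φ k x * jacobiWeight α β x := by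
    intro k c
    rw [hμ, setIntegral_withDensity_eq_setIntegral_smul hwm _ measurableSet_Iic,
      Measure.restrict_restrict measurableSet_Iic]
    have hset : Iic c ∩ Ioc 0 Real.pi = Ioc 0 (max 0 (min c Real.pi)) := by
      ext x
      simp only [mem_inter_iff, mem_Iic, mem_Ioc, le_max_iff, le_min_iff]
      constructor
      · rintro ⟨h1, h2, h3⟩
        exact ⟨h2, Or.inr ⟨h1, h3⟩⟩
      · rintro ⟨h1, h2 | h2⟩
        · exact absurd h1 h2.not_gt
        · exact ⟨h2.1, h1, h2.2⟩
    rw [hset]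
    refine setIntegral_congr_fun measurableSet_Ioc fun x hx => hwx x ⟨hx.1, hx.2.trans ?_⟩ _
    exact max_le Real.pi_pos.le (min_le_right _ _)
  have hIic : ∀ c, Tendsto (fun k => ∫ x in Iic c, φ k x ∂μ) atTop (nhds 0) := fun c => by
    simp only [hI]
    exact tendsto_setIntegral_jacobiR hβ hβα hα (le_max_left _ _)
      (max_le Real.pi_pos.le (min_le_right _ _))
  have huniv : Tendsto (fun k => ∫ x, φ k x ∂μ) atTop (nhds 0) := by
    refine (tendsto_setIntegral_jacobiR hβ hβα hα Real.pi_pos.le le_rfl).congr fun k => ?_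
    rw [hμ, integral_withDensity_eq_integral_smul hwm]
    exact setIntegral_congr_fun measurableSet_Ioc fun x hx => (hwx x hx _).symm
  have hfμ : Integrable f μ := by
    rw [hμ, integrable_withDensity_iff_integrable_smul hwm]
    exact IntegrableOn.congr_fun hf (fun x hx => (hwx x hx _).symm) measurableSet_Ioc
  refine (tendsto_integral_mul_of_tendsto_setIntegral_Iic (fun k => (hcont k).measurable) hb
    huniv hIic hfμ).congr fun k => ?_
  rw [hμ, integral_withDensity_eq_integral_smul hwm]
  exact setIntegral_congr_fun measurableSet_Ioc fun x hx => hwx x hx _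

/-- If the Riemann–Lebesgue lemma holds, the normalized Jacobi polynomials are uniformly
bounded on `[-1, 1]`. -/
lemma exists_bound_jacobiR {α β : ℝ}
    (h : ∀ f : ℝ → ℝ, MemJacobiL α β f →
      Tendsto (fun k : ℕ => fourierJacobi α β f k) atTop (nhds 0)) :
    ∃ M, ∀ k, ∀ x ∈ Icc (-1 : ℝ) 1, |jacobiR α β k x| ≤ M := by
  set φ : ℕ → ℝ → ℝ := fun k x => jacobiR α β k (Real.cos x) with hφ
  have hRcont : ∀ k, Continuous (jacobiR α β k) := fun k => by
    simpa only [eval_jacobiRPoly] using (jacobiRPoly α β k).continuous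
  have hcont : ∀ k, Continuous (φ k) := fun k => (hRcont k).comp Real.continuous_cos
  have hB : ∀ k, ∃ B, ∀ x, |φ k x| ≤ B := fun k => by
    obtain ⟨B, hB⟩ := isCompact_Icc.exists_bound_of_continuousOn
      (s := Icc (-1 : ℝ) 1) (hRcont k).continuousOn
    exact ⟨B, fun x => hB _ ⟨Real.neg_one_le_cos x, Real.cos_le_one x⟩⟩
  choose B hB using hB
  have hw : ∀ᵐ x ∂(volume.restrict (Ioc 0 Real.pi)), jacobiWeight α β x ≠ 0 := by
    rw [← restrict_Ioo_eq_restrict_Ioc]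
    exact ae_restrict_of_forall_mem measurableSet_Ioo fun x hx => (jacobiWeight_pos α β hx).ne'
  obtain ⟨M, hM⟩ := exists_ae_bound_of_tendsto_integral_mul
    (μ := volume.restrict (Ioc 0 Real.pi)) (fun k => (hcont k).measurable) hB fun g hg => by
      refine (h (fun x => g x / jacobiWeight α β x) ?_).congr fun k => integral_congr_ae ?_
      · refine hg.congr ?_
        filter_upwards [hw] with x hx
        rw [div_mul_cancel₀ _ hx]
      · filter_upwards [hw] with x hx
        simp only [hφ]
        field_simp
  refine ⟨M, fun k => ?_⟩
  have hIoo : ∀ θ ∈ Ioo 0 Real.pi, |φ k θ| ≤ M := by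
    have hopen : IsOpen ({θ | M < |φ k θ|} ∩ Ioo 0 Real.pi) :=
      (isOpen_lt continuous_const (hcont k).abs).inter isOpen_Ioo
    have hnull : volume ({θ | M < |φ k θ|} ∩ Ioo 0 Real.pi) = 0 := by
      have h1 := hM k
      rw [← restrict_Ioo_eq_restrict_Ioc, ae_restrict_iff' measurableSet_Ioo] at h1
      refine measure_mono_null (fun θ hθ => ?_) h1
      exact fun hc => (hc hθ.2).not_gt hθ.1
    have hempty := (hopen.measure_eq_zero_iff volume).1 hnull
    intro θ hθ
    by_contra hlt
    exact (hempty.subset ⟨not_le.1 hlt, hθ⟩).elim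
  have hIcc : ∀ θ ∈ Icc 0 Real.pi, |φ k θ| ≤ M := by
    rw [← closure_Ioo Real.pi_pos.ne]
    exact fun θ hθ => closure_minimal hIoo
      (isClosed_le (hcont k).abs continuous_const) hθ
  intro x hx
  have := hIcc (Real.arccos x) ⟨Real.arccos_nonneg x, Real.arccos_le_pi x⟩
  simpa only [hφ, Real.cos_arccos hx.1 hx.2] using this

/-- **Riemann–Lebesgue Lemma for Jacobi expansions.** For `α, β > -1`, the
Fourier–Jacobi coefficients of every `f ∈ L_{(α,β)}` tend to `0` as `k → ∞`
if and only if `(α, β) ∈ S`, i.e. `α ≥ β > -1` and `α ≥ -1/2`. -/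
theorem riemann_lebesgue_jacobi_iff (α β : ℝ) (hα : -1 < α) (hβ : -1 < β) :
    (∀ f : ℝ → ℝ, MemJacobiL α β f →
        Tendsto (fun k : ℕ => fourierJacobi α β f k) atTop (nhds 0)) ↔
      (β ≤ α ∧ -1 < β ∧ -(1/2) ≤ α) := by
  constructor
  · intro h
    obtain ⟨M, hM⟩ := exists_bound_jacobiR h
    have hβα : β ≤ α := by
      by_contra! hlt
      have hc : 0 < (β - α) / (1 + |α|) := div_pos (by linarith) (by positivity)
      obtain ⟨k, hk⟩ := ((Real.tendsto_sum_range_one_div_nat_succ_atTop.const_mul_atTop hc)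
        |>.eventually_gt_atTop M).exists
      have h1 := hM k (-1) (by norm_num)
      rw [abs_jacobiR_neg_one α β hα hβ, div_le_iff₀ (genBinom_pos α hα k)] at h1
      have h2 := genBinom_mul_sum_le hα hlt k
      nlinarith [genBinom_pos α hα k]
    refine ⟨hβα, hβ, ?_⟩
    by_contra! hlt
    obtain ⟨k, hk⟩ := ((tendsto_jacobiEigenvalue hα hβ).eventually
      (JacobiODE.eventually_unbounded hβ hβα hlt M)).exists
    refine hk (jacobiRPoly α β (k + 1)) (jacobiODE_jacobiRPoly α β hα hβ (k + 1)) ?_ ?_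
    · rw [eval_jacobiRPoly, jacobiR_one α β hα hβ]
    · simpa only [eval_jacobiRPoly] using hM (k + 1)
  · rintro ⟨hβα, -, hα'⟩ f hf
    exact tendsto_fourierJacobi hβ hβα hα' hf
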